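/- Fixed points of the cyclic projection method are optimal: in the discrete setting, suppose α ∈ ℝ^N, β ∈ ℝ^M and ρ ∈ ℝ^{N×M} satisfy ρᵢⱼ = (αᵢ + βⱼ − cᵢⱼ)₋ for all i, j, αᵢ = (γ/M)·(μᵢ − (1/γ)·∑ⱼ (ρᵢⱼ + βⱼ − cᵢⱼ)) for all i, and βⱼ = (γ/N)·(νⱼ − (1/γ)·∑ᵢ (ρᵢⱼ + αᵢ − cᵢⱼ)) for all j. Then the matrix π defined by πᵢⱼ := (αᵢ + βⱼ − cᵢⱼ)₊ / γ is feasible and is an optimal solution of the quadratically regularized discrete optimal transport problem. -/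

import Mathlib

open Finset

/-- Feasibility for the discrete transport problem: `π` is entrywise nonnegative with
row sums `μ` and column sums `ν`. -/
def IsFeasible {N M : ℕ} (μ : Fin N → ℝ) (ν : Fin M → ℝ)
    (π : Matrix (Fin N) (Fin M) ℝ) : Prop :=
  (∀ i j, 0 ≤ π i j) ∧ (∀ i, ∑ j, π i j = μ i) ∧ (∀ j, ∑ i, π i j = ν j)

/-- The quadratically regularized discrete transport cost. -/
noncomputable def quadCost {N M : ℕ} (c : Matrix (Fin N) (Fin M) ℝ) (γ : ℝ)
    (π : Matrix (Fin N) (Fin M) ℝ) : ℝ :=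
  (∑ i, ∑ j, c i j * π i j) + γ / 2 * ∑ i, ∑ j, π i j ^ 2

/-- A scalar fixed point equation for `a` forces the positive parts of `a + bⱼ - kⱼ`,
divided by `γ`, to have total mass `m`. -/
lemma sum_posPart_div_of_fixed_point {n : ℕ} (hn : n ≠ 0) {γ : ℝ} (hγ : γ ≠ 0) {a m : ℝ}
    {b k : Fin n → ℝ}
    (h : a = γ / (n : ℝ) *
      (m - (1 / γ) * ∑ j, (max (-(a + b j - k j)) 0 + b j - k j))) :
    ∑ j, max (a + b j - k j) 0 / γ = m := by
  have hn' : (n : ℝ) ≠ 0 := Nat.cast_ne_zero.mpr hn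
  have hsum : ∑ j, max (a + b j - k j) 0
      = n * a + ∑ j, (max (-(a + b j - k j)) 0 + b j - k j) := by
    have hconst : (n : ℝ) * a = ∑ _j : Fin n, a := by simp
    rw [hconst, ← sum_add_distrib]
    refine sum_congr rfl fun j _ => ?_
    rcases le_total 0 (a + b j - k j) with hx | hx
    · rw [max_eq_left hx, max_eq_right (by linarith)]; ring
    · rw [max_eq_right hx, max_eq_left (by linarith)]; ring
  rw [← sum_div, hsum, div_eq_iff hγ]
  generalize ∑ j, (max (-(a + b j - k j)) 0 + b j - k j) = S at h
  field_simp at h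
  linarith

/-- If two nonnegative vectors have equal mass and one of them is indexed by the empty type,
then the other vanishes. -/
lemma eq_zero_of_mass_eq_of_index_zero {n m : ℕ} {p : Fin n → ℝ} {q : Fin m → ℝ}
    (hp : ∀ i, 0 ≤ p i) (hmass : ∑ i, p i = ∑ j, q j) (hm : m = 0) (i : Fin n) : p i = 0 := by
  subst hm
  rw [Fin.sum_univ_zero] at hmass
  exact (sum_eq_zero_iff_of_nonneg fun i _ => hp i).mp hmass i (mem_univ i)

/-- The scalar function `t ↦ -x t + γ t² / 2` is minimized over `t ≥ 0` at `x₊ / γ`. -/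
lemma posPart_div_minimizes {γ : ℝ} (hγ : 0 < γ) (x : ℝ) {t : ℝ} (ht : 0 ≤ t) :
    -x * (max x 0 / γ) + γ / 2 * (max x 0 / γ) ^ 2 ≤ -x * t + γ / 2 * t ^ 2 := by
  rcases le_total 0 x with hx | hx
  · obtain ⟨s, rfl⟩ : ∃ s, x = γ * s := ⟨x / γ, by field_simp⟩
    rw [max_eq_left hx, mul_div_cancel_left₀ _ hγ.ne']
    nlinarith [mul_nonneg hγ.le (sq_nonneg (t - s))]
  · rw [max_eq_right hx]
    have h₁ : 0 ≤ -x * t := mul_nonneg (by linarith) ht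
    have h₂ : 0 ≤ γ / 2 * t ^ 2 := by positivity
    simpa using add_nonneg h₁ h₂

/-- On feasible plans the cost splits into a part depending only on the marginals and a sum
of scalar functions of the entries. -/
lemma quadCost_eq_of_isFeasible {N M : ℕ} {μ : Fin N → ℝ} {ν : Fin M → ℝ}
    (c : Matrix (Fin N) (Fin M) ℝ) (γ : ℝ) (α : Fin N → ℝ) (β : Fin M → ℝ)
    {π : Matrix (Fin N) (Fin M) ℝ} (hπ : IsFeasible μ ν π) :
    quadCost c γ π = (∑ i, α i * μ i + ∑ j, β j * ν j)
      + ∑ i, ∑ j, (-(α i + β j - c i j) * π i j + γ / 2 * π i j ^ 2) := by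
  have hα : ∑ i, α i * μ i = ∑ i, ∑ j, α i * π i j :=
    sum_congr rfl fun i _ => by rw [← hπ.2.1 i, mul_sum]
  have hβ : ∑ j, β j * ν j = ∑ i, ∑ j, β j * π i j := by
    rw [sum_comm]
    exact sum_congr rfl fun j _ => by rw [← hπ.2.2 j, mul_sum]
  rw [quadCost, hα, hβ]
  simp only [mul_sum, ← sum_add_distrib]
  exact sum_congr rfl fun i _ => sum_congr rfl fun j _ => by ring

/-- Fixed points of the cyclic projection method are optimal: if `(ρ, α, β)` satisfies the
fixed point equations of Algorithm 1, then `πᵢⱼ = (αᵢ + βⱼ − cᵢⱼ)₊/γ` is feasible and solves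
the quadratically regularized discrete optimal transport problem. -/
theorem cyclic_projection_fixed_point_optimal {N M : ℕ} (μ : Fin N → ℝ) (ν : Fin M → ℝ)
    (hμ : ∀ i, 0 ≤ μ i) (hν : ∀ j, 0 ≤ ν j) (hmass : ∑ i, μ i = ∑ j, ν j)
    (c : Matrix (Fin N) (Fin M) ℝ) (γ : ℝ) (hγ : 0 < γ)
    (α : Fin N → ℝ) (β : Fin M → ℝ) (ρ : Matrix (Fin N) (Fin M) ℝ)
    (hρ : ∀ i j, ρ i j = max (-(α i + β j - c i j)) 0)
    (hα : ∀ i, α i = γ / (M : ℝ) * (μ i - (1 / γ) * ∑ j, (ρ i j + β j - c i j)))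
    (hβ : ∀ j, β j = γ / (N : ℝ) * (ν j - (1 / γ) * ∑ i, (ρ i j + α i - c i j))) :
    IsFeasible μ ν (fun i j => max (α i + β j - c i j) 0 / γ) ∧
    ∀ π', IsFeasible μ ν π' →
      quadCost c γ (fun i j => max (α i + β j - c i j) 0 / γ) ≤ quadCost c γ π' := by
  have hfeas : IsFeasible μ ν (fun i j => max (α i + β j - c i j) 0 / γ) := by
    refine ⟨fun i j => div_nonneg (le_max_right _ _) hγ.le, fun i => ?_, fun j => ?_⟩
    · by_cases hM : M = 0
      · rw [eq_zero_of_mass_eq_of_index_zero hμ hmass hM i]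
        subst hM
        simp
      · refine sum_posPart_div_of_fixed_point hM hγ.ne' ?_
        simpa only [hρ] using hα i
    · by_cases hN : N = 0
      · rw [eq_zero_of_mass_eq_of_index_zero hν hmass.symm hN j]
        subst hN
        simp
      · simp only [add_comm (α _) (β j)]
        refine sum_posPart_div_of_fixed_point hN hγ.ne' ?_
        simpa only [hρ, add_comm (α _) (β j)] using hβ j
  refine ⟨hfeas, fun π' hπ' => ?_⟩
  rw [quadCost_eq_of_isFeasible c γ α β hfeas, quadCost_eq_of_isFeasible c γ α β hπ']
  refine add_le_add_right ?_ _
  exact sum_le_sum fun i _ => sum_le_sum fun j _ => posPart_div_minimizes hγ _ (hπ'.1 i j)
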